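/- arXiv:2307.13252 — 2 statements merged into one kernel-verified Lean document; each statement's English description precedes it below -/
import Mathlib

section
/- Let a, b > 0 be real numbers. If the greedy lattice paths coincide, i.e. g^a(k) = g^b(k) for all k ∈ ℕ, then a = b. -/
/-- The greedy lattice path `g^a : ℕ → (ℤ≥0)²`: start at `(0,0)` and step to the
right whenever `a * (y + 1) ≥ x + 1`, otherwise step up. -/
noncomputable def greedy (a : ℝ) : ℕ → ℕ × ℕ
  | 0 => (0, 0)
  | k + 1 =>
    if ((greedy a k).1 + 1 : ℝ) ≤ a * ((greedy a k).2 + 1)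
    then ((greedy a k).1 + 1, (greedy a k).2)
    else ((greedy a k).1, (greedy a k).2 + 1)

theorem greedy_bounds {a : ℝ} (ha : 0 < a) (k : ℕ) :
    ((greedy a k).1 : ℝ) ≤ a * ((greedy a k).2 + 1) ∧
      a * (greedy a k).2 < (greedy a k).1 + 1 := by
  induction k with
  | zero => simp [greedy, ha.le]
  | succ k ih =>
    obtain ⟨h₁, h₂⟩ := ih
    rw [greedy]
    split_ifs with hc
    · push_cast
      exact ⟨hc, by linarith⟩
    · push_cast
      exact ⟨by linarith, not_le.mp hc⟩

theorem greedy_fst_add_snd (a : ℝ) (k : ℕ) : (greedy a k).1 + (greedy a k).2 = k := by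
  induction k with
  | zero => simp [greedy]
  | succ k ih =>
    rw [greedy]
    split_ifs <;> simp only <;> omega

theorem le_of_greedy_eq {a b : ℝ} (ha : 0 < a) (hb : 0 < b)
    (h : ∀ k : ℕ, greedy a k = greedy b k) : b ≤ a := by
  by_contra! hab
  have hd : 0 < b - a := sub_pos.mpr hab
  obtain ⟨k, hk⟩ := exists_nat_gt (((a + 1) ^ 2 + a * (b - a)) / (b - a))
  rw [div_lt_iff₀ hd] at hk
  have h₁ := (greedy_bounds ha k).1
  have h₂ := (greedy_bounds hb k).2
  have hsum : ((greedy a k).1 : ℝ) + (greedy a k).2 = k := by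
    exact_mod_cast greedy_fst_add_snd a k
  rw [← h k] at h₂
  generalize ((greedy a k).1 : ℝ) = x at *
  generalize ((greedy a k).2 : ℝ) = y at *
  have hy : (b - a) * y < a + 1 := by linarith
  have hky : (k : ℝ) - a ≤ (a + 1) * y := by linarith
  have h₃ := mul_le_mul_of_nonneg_left hky hd.le
  have h₄ := mul_lt_mul_of_pos_left hy (by linarith : 0 < a + 1)
  linarith

/-- If the greedy lattice paths of `a, b > 0` coincide, then `a = b`. -/
theorem stmt_5 (a b : ℝ) (ha : 0 < a) (hb : 0 < b)
    (h : ∀ k : ℕ, greedy a k = greedy b k) : a = b :=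
  le_antisymm (le_of_greedy_eq hb ha fun k => (h k).symm) (le_of_greedy_eq ha hb h)
end

section
/- Let n ≥ 1, let a = (a₁,…,aₙ) be positive real numbers that are rationally independent, let k ≥ 1, and let v ∈ ℤⁿ have at least one positive component. If max_{1≤i≤n} aᵢvᵢ = max_{1≤i≤n} aᵢ(Γ^a_k)ᵢ, then vⱼ ≤ (Γ^a_k)ⱼ for every 1 ≤ j ≤ n. -/
/-- Integer multiples of two distinct members of a rationally independent family are never equal,
unless both are zero. -/
theorem eq_zero_of_mul_natCast_eq {ι : Type*} {a : ι → ℝ} (hind : LinearIndependent ℚ a)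
    {i j : ι} (hij : i ≠ j) {x y : ℕ} (h : a i * (x : ℝ) = a j * (y : ℝ)) : x = 0 := by
  have hinj : Function.Injective ![i, j] := by
    intro p q hpq
    fin_cases p <;> fin_cases q <;> simp_all
  have hcomp : LinearIndependent ℚ ![a i, a j] := by
    convert hind.comp _ hinj using 1
    ext p
    fin_cases p <;> rfl
  have hzero := (LinearIndependent.pair_iff.mp hcomp) (x : ℚ) (-(y : ℚ)) (by
    simp only [Rat.smul_def]
    push_cast
    linarith)
  exact_mod_cast hzero.1


/-- If `v ∈ ℤⁿ` has a positive component and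
`max_i (a i * v i) = max_i (a i * Γ i)` where `Γ` is the admissible minimizer at
level `k ≥ 1`, then every component of `v` is at most the corresponding component
of `Γ`. -/
theorem stmt_7 (n : ℕ) (hn : 1 ≤ n) (a : Fin n → ℝ) (hpos : ∀ i, 0 < a i)
    (hind : LinearIndependent ℚ a) (k : ℕ) (hk : 1 ≤ k)
    (Γ : Fin n → ℕ) (hΓsum : ∑ i, Γ i = k)
    (hΓmin : ∀ w : Fin n → ℕ, ∑ i, w i = k →
      (⨆ i, a i * (Γ i : ℝ)) ≤ ⨆ i, a i * (w i : ℝ))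
    (v : Fin n → ℤ) (hvpos : ∃ i, 0 < v i)
    (heq : (⨆ i, a i * (v i : ℝ)) = ⨆ i, a i * (Γ i : ℝ)) :
    ∀ j, v j ≤ (Γ j : ℤ) := by
  intro j
  by_contra! hj
  have : Nonempty (Fin n) := ⟨j⟩
  obtain ⟨i, hi⟩ := exists_eq_ciSup_of_finite (f := fun i => a i * (Γ i : ℝ))
  have hΓle : ∀ l, a l * (Γ l : ℝ) ≤ a i * (Γ i : ℝ) := fun l =>
    hi ▸ le_ciSup (f := fun i => a i * (Γ i : ℝ)) (Set.finite_range _).bddAbove l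
  have hvle : ∀ l, a l * (v l : ℝ) ≤ a i * (Γ i : ℝ) := fun l =>
    hi ▸ heq ▸ le_ciSup (f := fun i => a i * (v i : ℝ)) (Set.finite_range _).bddAbove l
  have hmax_pos : 0 < a i * (Γ i : ℝ) := by
    obtain ⟨l, hl⟩ := hvpos
    exact (mul_pos (hpos l) (by exact_mod_cast hl)).trans_le (hvle l)
  have hΓi : 0 < Γ i := by
    exact_mod_cast pos_of_mul_pos_right hmax_pos (hpos i).le
  have hsucc : a j * ((Γ j + 1 : ℕ) : ℝ) ≤ a i * (Γ i : ℝ) :=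
    (mul_le_mul_of_nonneg_left (by exact_mod_cast hj) (hpos j).le).trans (hvle j)
  have hij : i ≠ j := by
    rintro rfl
    have := le_of_mul_le_mul_left hsucc (hpos i)
    norm_cast at this
    omega
  -- Moving one unit from the maximizing coordinate `i` to `j` strictly lowers the maximum.
  let w : Fin n → ℕ := fun l => if l = i then Γ i - 1 else if l = j then Γ j + 1 else Γ l
  have hwsum : ∑ l, w l = k := by
    have hshift : ∀ l, w l + (if l = i then 1 else 0) = Γ l + (if l = j then 1 else 0) := by
      intro l
      by_cases hli : l = i
      · subst hli
        simp only [w, if_true, if_neg hij]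
        omega
      · by_cases hlj : l = j
        · subst hlj
          simp [w, hli]
        · simp [w, hli, hlj]
    have hsum := Finset.sum_congr (rfl : (Finset.univ : Finset (Fin n)) = _) fun l _ => hshift l
    simp only [Finset.sum_add_distrib, Finset.sum_ite_eq', Finset.mem_univ, if_true] at hsum
    omega
  have hwlt : ∀ l, a l * (w l : ℝ) < a i * (Γ i : ℝ) := by
    intro l
    by_cases hli : l = i
    · subst hli
      refine mul_lt_mul_of_pos_left ?_ (hpos l)
      simp only [w, if_true]
      exact_mod_cast Nat.sub_lt hΓi one_pos
    · have hwle : a l * (w l : ℝ) ≤ a i * (Γ i : ℝ) := by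
        by_cases hlj : l = j
        · subst hlj
          simpa only [w, if_neg hli, if_true] using hsucc
        · simpa only [w, if_neg hli, if_neg hlj] using hΓle l
      refine hwle.lt_of_ne fun h => hΓi.ne' ?_
      exact eq_zero_of_mul_natCast_eq hind (Ne.symm hli) h.symm
  obtain ⟨m, hm⟩ := exists_eq_ciSup_of_finite (f := fun l => a l * (w l : ℝ))
  have hle := hΓmin w hwsum
  rw [← hi, ← hm] at hle
  exact (hwlt m).not_ge hle
end
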